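/- Fix a 2k×2k symmetric homogeneous matrix A of non-negative integers. For a general choice of k skew-symmetric 2k×2k matrices G_1, …, G_k of homogeneous forms in four variables, each with degree matrix A, the ideal generated by the submaximal Pfaffians of all the G_i coincides with the polynomial ring R = ℂ[x1,x2,x3,x4] in every degree d ≥ tr(A)/2. -/

import Mathlib

open MvPolynomial

/-- The Pfaffian of a `2n × 2n` matrix of multivariate polynomials over `ℂ`,
given by the standard averaged signed sum over permutations. -/
noncomputable def pfaff {σ : Type*} {n : ℕ}
    (M : Matrix (Fin (2*n)) (Fin (2*n)) (MvPolynomial σ ℂ)) : MvPolynomial σ ℂ :=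
  (((2^n * n.factorial : ℕ) : ℂ)⁻¹) •
    ∑ p : Equiv.Perm (Fin (2*n)),
      (Equiv.Perm.sign p : ℤ) •
        ∏ i : Fin n, M (p ⟨2*i.1, by have := i.2; omega⟩) (p ⟨2*i.1+1, by have := i.2; omega⟩)

/-- A square matrix of polynomials is skew-symmetric. -/
def IsSkew {m : Type*} {R : Type*} [Ring R] (M : Matrix m m R) : Prop :=
  ∀ i j, M j i = - M i j

/-- A square integer matrix is homogeneous. -/
def HomogMat {m : Type*} (A : Matrix m m ℕ) : Prop :=
  ∀ i j l r, A i j + A l r = A i r + A l j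

/-- A matrix of polynomials has degree matrix `A`. -/
def DegMat {σ m : Type*} (M : Matrix m m (MvPolynomial σ ℂ)) (A : Matrix m m ℕ) : Prop :=
  ∀ i j, (M i j).IsHomogeneous (A i j)

/-- The set of submaximal Pfaffians of a skew-symmetric matrix of even size `2k`:
Pfaffians of the submatrices obtained by erasing two rows and the two columns
with the same indexes. -/
def submaxPfEven {σ : Type*} {k : ℕ}
    (M : Matrix (Fin (2*k)) (Fin (2*k)) (MvPolynomial σ ℂ)) : Set (MvPolynomial σ ℂ) :=
  { q | ∃ e : Fin (2*(k-1)) ↪o Fin (2*k), q = pfaff (M.submatrix e e) }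

/-- The set of submaximal Pfaffians of a skew-symmetric matrix of odd size `2k-1`:
Pfaffians of the submatrices obtained by erasing one row and the column
with the same index. -/
def submaxPfOdd {σ : Type*} {k : ℕ}
    (M : Matrix (Fin (2*k-1)) (Fin (2*k-1)) (MvPolynomial σ ℂ)) : Set (MvPolynomial σ ℂ) :=
  { q | ∃ e : Fin (2*(k-1)) ↪o Fin (2*k-1), q = pfaff (M.submatrix e e) }

/-! ### Pfaffians -/

/-- The index set `Fin (2 * n)` as `n` consecutive pairs. -/
def pairEquiv (n : ℕ) : Fin n × Fin 2 ≃ Fin (2 * n) where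
  toFun x := ⟨2 * x.1.1 + x.2.1, by omega⟩
  invFun a := (⟨a.1 / 2, by omega⟩, ⟨a.1 % 2, by omega⟩)
  left_inv := by
    rintro ⟨⟨i, hi⟩, ⟨s, hs⟩⟩
    ext <;> simp <;> omega
  right_inv := by
    rintro ⟨a, ha⟩
    ext
    simp
    omega

theorem pfaff_eq_pairEquiv {σ : Type*} {n : ℕ}
    (M : Matrix (Fin (2*n)) (Fin (2*n)) (MvPolynomial σ ℂ)) :
    pfaff M = (((2^n * n.factorial : ℕ) : ℂ)⁻¹) •
      ∑ p : Equiv.Perm (Fin (2*n)), (Equiv.Perm.sign p : ℤ) •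
        ∏ i : Fin n, M (p (pairEquiv n (i, 0))) (p (pairEquiv n (i, 1))) := rfl

theorem prod_pairEquiv {R : Type*} [CommMonoid R] {n : ℕ} (f : Fin (2 * n) → R) :
    ∏ i : Fin n, f (pairEquiv n (i, 0)) * f (pairEquiv n (i, 1)) = ∏ a, f a := by
  rw [← (pairEquiv n).prod_comp, Fintype.prod_prod_type]
  simp [Fin.prod_univ_two]

theorem sum_pairEquiv {R : Type*} [AddCommMonoid R] {n : ℕ} (f : Fin (2 * n) → R) :
    ∑ i : Fin n, (f (pairEquiv n (i, 0)) + f (pairEquiv n (i, 1))) = ∑ a, f a := by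
  rw [← (pairEquiv n).sum_comp, Fintype.sum_prod_type]
  simp [Fin.sum_univ_two]

theorem pfaff_submatrix_perm {σ : Type*} {n : ℕ}
    (M : Matrix (Fin (2*n)) (Fin (2*n)) (MvPolynomial σ ℂ)) (τ : Equiv.Perm (Fin (2*n))) :
    pfaff (M.submatrix τ τ) = (Equiv.Perm.sign τ : ℤ) • pfaff M := by
  rw [pfaff_eq_pairEquiv, pfaff_eq_pairEquiv, smul_comm (Equiv.Perm.sign τ : ℤ),
    Finset.smul_sum (r := (Equiv.Perm.sign τ : ℤ))]
  congr 1
  refine Fintype.sum_equiv (Equiv.mulLeft τ) _ _ fun p => ?_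
  rw [smul_smul, Equiv.coe_mulLeft, Equiv.Perm.sign_mul, Units.val_mul, ← mul_assoc,
    Int.units_coe_mul_self, one_mul]
  rfl

theorem pfaff_scale {σ : Type*} {n : ℕ}
    (M : Matrix (Fin (2*n)) (Fin (2*n)) (MvPolynomial σ ℂ)) (d : Fin (2*n) → MvPolynomial σ ℂ) :
    pfaff (Matrix.of fun a b => d a * M a b * d b) = (∏ a, d a) * pfaff M := by
  rw [pfaff_eq_pairEquiv, pfaff_eq_pairEquiv, mul_smul_comm, Finset.mul_sum]
  congr 1
  refine Finset.sum_congr rfl fun p _ => ?_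
  rw [mul_smul_comm]
  congr 1
  rw [← Equiv.prod_comp p d, ← prod_pairEquiv, ← Finset.prod_mul_distrib]
  exact Finset.prod_congr rfl fun i _ => by rw [Matrix.of_apply]; ring

theorem pfaff_isWeightedHomogeneous {σ : Type*} {n : ℕ} (w : σ → ℤ) (β : Fin (2*n) → ℤ)
    (M : Matrix (Fin (2*n)) (Fin (2*n)) (MvPolynomial σ ℂ))
    (hM : ∀ a b, IsWeightedHomogeneous w (M a b) (β a + β b)) :
    IsWeightedHomogeneous w (pfaff M) (∑ a, β a) := by
  rw [pfaff_eq_pairEquiv, ← mem_weightedHomogeneousSubmodule]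
  refine Submodule.smul_mem _ _ (Submodule.sum_mem _ fun p _ => ?_)
  refine zsmul_mem ?_ _
  rw [mem_weightedHomogeneousSubmodule, ← Equiv.sum_comp p β, ← sum_pairEquiv]
  exact IsWeightedHomogeneous.prod _ _ _ fun i _ => hM _ _

/-- A permutation of `ι × Fin 2` preserving the fibres of the first projection is a permutation
of `ι` followed by flips of the fibres. -/
theorem sign_eq_prod_of_preserves_pairs {n : ℕ} (p : Equiv.Perm (Fin n × Fin 2))
    (hp : ∀ i, (p (i, 0)).1 = (p (i, 1)).1) :
    Function.Bijective (fun i => (p (i, 0)).1) ∧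
      (Equiv.Perm.sign p : ℤ) = ∏ i, if (p (i, 0)).2 = 0 then 1 else -1 := by
  have hfst : ∀ x, (p x).1 = (p (x.1, 0)).1 := by
    rintro ⟨i, s⟩
    fin_cases s
    · rfl
    · exact (hp i).symm
  have hsurj : Function.Surjective (fun i => (p (i, 0)).1) := fun j => by
    obtain ⟨x, hx⟩ := p.surjective (j, 0)
    exact ⟨x.1, by simp [← hfst, hx]⟩
  have hbij : Function.Bijective (fun i => (p (i, 0)).1) :=
    (Finite.injective_iff_bijective.mp (Finite.injective_iff_surjective.mpr hsurj))
  refine ⟨hbij, ?_⟩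
  let π : Equiv.Perm (Fin n) := Equiv.ofBijective _ hbij
  let τ : Fin n → Equiv.Perm (Fin 2) := fun i =>
    if (p (i, 0)).2 = 0 then 1 else Equiv.swap 0 1
  have hsnd : ∀ i, (p (i, 1)).2 = Equiv.swap 0 1 (p (i, 0)).2 := by
    intro i
    have h1 : (p (i, 1)).2 ≠ (p (i, 0)).2 := fun h => by
      have := p.injective (Prod.ext (hp i).symm h)
      simp at this
    generalize (p (i, 1)).2 = a at *
    generalize (p (i, 0)).2 = b at *
    revert h1
    revert a b
    decide
  have hdec : p = (Equiv.prodCongrLeft fun _ : Fin 2 => π) * Equiv.prodCongrRight τ := by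
    ext1 ⟨i, s⟩
    refine Prod.ext (by rw [hfst]; rfl) ?_
    have h01 : (p (i, 0)).2 = 0 ∨ (p (i, 0)).2 = 1 := by
      generalize (p (i, 0)).2 = a
      revert a
      decide
    fin_cases s
    · rcases h01 with h | h <;> simp [τ, h]
    · rcases h01 with h | h <;> simp [τ, h, hsnd]
  conv_lhs => rw [hdec]
  rw [Equiv.Perm.sign_mul, Equiv.Perm.sign_prodCongrLeft, Equiv.Perm.sign_prodCongrRight]
  simp only [Finset.prod_const, Finset.card_univ, Fintype.card_fin, Int.units_sq, one_mul,
    Units.coe_prod]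
  refine Finset.prod_congr rfl fun i _ => ?_
  by_cases h : (p (i, 0)).2 = 0 <;> simp [τ, h]

/-- The Pfaffian of a block diagonal matrix with skew-symmetric `2 × 2` blocks is a nonzero
multiple of the product of the entries of the blocks. -/
theorem exists_pfaff_eq_smul_prod {σ : Type*} {n : ℕ} (f : Fin n → MvPolynomial σ ℂ)
    (M : Matrix (Fin (2*n)) (Fin (2*n)) (MvPolynomial σ ℂ))
    (h01 : ∀ i, M (pairEquiv n (i, 0)) (pairEquiv n (i, 1)) = f i)
    (h10 : ∀ i, M (pairEquiv n (i, 1)) (pairEquiv n (i, 0)) = - f i)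
    (h0 : ∀ i j s t, i ≠ j → M (pairEquiv n (i, s)) (pairEquiv n (j, t)) = 0) :
    ∃ c : ℂ, c ≠ 0 ∧ pfaff M = c • ∏ i, f i := by
  classical
  let e := pairEquiv n
  let B : Equiv.Perm (Fin n × Fin 2) → Prop := fun p => ∀ i, (p (i, 0)).1 = (p (i, 1)).1
  have hterm : ∀ p : Equiv.Perm (Fin n × Fin 2),
      (Equiv.Perm.sign p : ℤ) • ∏ i, M (e (p (i, 0))) (e (p (i, 1))) =
        if B p then ∏ i, f i else 0 := by
    intro p
    split_ifs with hB
    · obtain ⟨hbij, hsign⟩ := sign_eq_prod_of_preserves_pairs p hB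
      have hfac : ∀ i, M (e (p (i, 0))) (e (p (i, 1))) =
          ((if (p (i, 0)).2 = 0 then 1 else -1 : ℤ) : MvPolynomial σ ℂ) * f (p (i, 0)).1 := by
        intro i
        have h1 : (p (i, 1)).2 ≠ (p (i, 0)).2 := fun h => by
          have := p.injective (Prod.ext (hB i).symm h)
          simp at this
        have h2 := hB i
        generalize p (i, 0) = x at *
        generalize p (i, 1) = y at *
        obtain ⟨j, s⟩ := x
        obtain ⟨j', t⟩ := y
        simp only at h1 h2 ⊢
        subst h2
        fin_cases s <;> fin_cases t <;> simp_all [e]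
      simp_rw [hfac]
      rw [Finset.prod_mul_distrib, hsign, zsmul_eq_mul, ← mul_assoc, ← Int.cast_prod, ← Int.cast_mul,
        ← Finset.prod_mul_distrib, Finset.prod_eq_one, Int.cast_one, one_mul]
      · exact hbij.prod_comp f
      · intro i _
        split_ifs <;> norm_num
    · obtain ⟨i, hi⟩ := not_forall.mp hB
      rw [Finset.prod_eq_zero (Finset.mem_univ i), smul_zero]
      exact h0 _ _ _ _ hi
  have hsum : pfaff M = (((2^n * n.factorial : ℕ) : ℂ)⁻¹) •
      ∑ p : Equiv.Perm (Fin n × Fin 2), if B p then ∏ i, f i else 0 := by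
    rw [pfaff_eq_pairEquiv]
    congr 1
    refine (Fintype.sum_equiv e.permCongr _ _ fun p => ?_).symm
    rw [← hterm, Equiv.Perm.sign_permCongr]
    simp [Equiv.permCongr_apply, e]
  refine ⟨((2^n * n.factorial : ℕ) : ℂ)⁻¹ * (Finset.univ.filter B).card, ?_, ?_⟩
  · refine mul_ne_zero (inv_ne_zero ?_) ?_
    · exact Nat.cast_ne_zero.mpr (by positivity)
    · refine Nat.cast_ne_zero.mpr (Finset.card_ne_zero_of_mem (a := 1) ?_)
      simp [B]
  · rw [hsum, ← Finset.sum_filter, Finset.sum_const, mul_smul, Nat.cast_smul_eq_nsmul]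

/-! ### Tuples of matrices and polynomial functions of their coefficients -/

/-- A `k`-tuple of `2k × 2k` matrices of polynomials in four variables. -/
abbrev MatTuple (k : ℕ) := Fin k → Matrix (Fin (2*k)) (Fin (2*k)) (MvPolynomial (Fin 4) ℂ)

/-- The coefficients of a tuple of matrices. -/
def MatTuple.coeffs {k : ℕ} (G : MatTuple k) :
    Fin k × Fin (2*k) × Fin (2*k) × ((Fin 4) →₀ ℕ) → ℂ :=
  fun x => MvPolynomial.coeff x.2.2.2 (G x.1 x.2.1 x.2.2.1)

/-- The complex functions of a tuple of matrices which are polynomials in its coefficients. -/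
noncomputable def polyFun (k : ℕ) : Subalgebra ℂ (MatTuple k → ℂ) :=
  (AlgHom.pi fun G : MatTuple k => (aeval G.coeffs : _ →ₐ[ℂ] ℂ)).range

theorem mem_polyFun {k : ℕ} {f : MatTuple k → ℂ} :
    f ∈ polyFun k ↔ ∃ P, ∀ G : MatTuple k, eval G.coeffs P = f G := by
  simp only [polyFun, AlgHom.mem_range, funext_iff, AlgHom.pi_apply, aeval_eq_eval]

/-- The polynomial-valued functions of a tuple of matrices whose coefficients are polynomials in
the coefficients of the tuple. -/
noncomputable def polyValued (k : ℕ) :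
    Subalgebra (MvPolynomial (Fin 4) ℂ) (MatTuple k → MvPolynomial (Fin 4) ℂ) where
  carrier := {F | ∀ m, (fun G => coeff m (F G)) ∈ polyFun k}
  add_mem' {F H} hF hH m := by
    simp only [Pi.add_apply, coeff_add]
    exact add_mem (hF m) (hH m)
  mul_mem' {F H} hF hH m := by
    simp only [Pi.mul_apply, coeff_mul]
    convert sum_mem (S := polyFun k) (t := Finset.HasAntidiagonal.antidiagonal m) (fun x _ =>
      mul_mem (hF x.1) (hH x.2)) using 1
    ext G
    simp
  algebraMap_mem' F m := (polyFun k).algebraMap_mem (coeff m F)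

theorem entry_mem_polyValued {k : ℕ} (i : Fin k) (a b : Fin (2*k)) :
    (fun G => G i a b) ∈ polyValued k := fun m =>
  mem_polyFun.mpr ⟨X (i, a, b, m), fun G => by simp [MatTuple.coeffs]⟩

theorem pfaff_mem_polyValued {k n : ℕ} (i : Fin k) (e : Fin (2*n) → Fin (2*k)) :
    (fun G : MatTuple k => pfaff ((G i).submatrix e e)) ∈ polyValued k := by
  have h : (fun G : MatTuple k => pfaff ((G i).submatrix e e)) =
      (C (((2^n * n.factorial : ℕ) : ℂ)⁻¹) : MvPolynomial (Fin 4) ℂ) •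
      ∑ p : Equiv.Perm (Fin (2*n)), (Equiv.Perm.sign p : ℤ) •
        ∏ j : Fin n, fun G : MatTuple k =>
          G i (e (p (pairEquiv n (j, 0)))) (e (p (pairEquiv n (j, 1)))) := by
    ext1 G
    rw [pfaff_eq_pairEquiv, ← C_mul']
    simp only [Pi.smul_apply, smul_eq_mul, Finset.sum_apply, Finset.prod_apply,
      Matrix.submatrix_apply]
  rw [h]
  exact Subalgebra.smul_mem _ (sum_mem fun p _ => zsmul_mem (prod_mem fun j _ =>
    entry_mem_polyValued _ _ _) _) _

/-- The ideal generated by the Pfaffians of the submatrices of size `2 (k - 1)` of the matrices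
`G i` whose rows avoid `S i`. -/
noncomputable def pfIdeal {k : ℕ} (S : Fin k → Set (Fin (2*k))) (G : MatTuple k) :
    Ideal (MvPolynomial (Fin 4) ℂ) :=
  Ideal.span {f | ∃ i, ∃ e : Fin (2*(k-1)) → Fin (2*k), Function.Injective e ∧ (∀ j, e j ∉ S i) ∧
    f = pfaff ((G i).submatrix e e)}

/-- The ideal `I` coincides with the polynomial ring in degree `t`. -/
def Fills (I : Ideal (MvPolynomial (Fin 4) ℂ)) (t : ℕ) : Prop :=
  ∀ F : MvPolynomial (Fin 4) ℂ, F.IsHomogeneous t → F ∈ I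

/-- `G` is a tuple of skew-symmetric matrices of forms; the `(a, b)` entry of `G i` has degree
`(β i a + β i b) / 2`, and vanishes if this is not a natural number. -/
def SkewOfDegrees {k : ℕ} (β : Fin k → Fin (2*k) → ℤ) (G : MatTuple k) : Prop :=
  ∀ i, IsSkew (G i) ∧
    ∀ a b, IsWeightedHomogeneous (fun _ => (2 : ℤ)) (G i a b) (β i a + β i b)

theorem weight_const_two (m : Fin 4 →₀ ℕ) :
    Finsupp.weight (fun _ => (2 : ℤ)) m = 2 * (m.degree : ℤ) := by
  rw [Finsupp.weight_apply, Finsupp.degree_eq_sum, Finsupp.sum_fintype _ _ (by simp)]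
  push_cast
  rw [Finset.mul_sum]
  exact Finset.sum_congr rfl fun i _ => by simp [mul_comm]

theorem exists_isHomogeneous_of_isWeightedHomogeneous {F : MvPolynomial (Fin 4) ℂ} {c : ℤ}
    (h : IsWeightedHomogeneous (fun _ => (2 : ℤ)) F c) : ∃ n, F.IsHomogeneous n := by
  by_cases hF : F = 0
  · exact ⟨0, hF ▸ isHomogeneous_zero _ _ _⟩
  · obtain ⟨m, hm⟩ := exists_coeff_ne_zero hF
    refine ⟨m.degree, fun m' hm' => ?_⟩
    have h1 := h hm
    have h2 := h hm'
    rw [weight_const_two] at h1 h2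
    rw [Pi.one_def, ← Finsupp.degree_eq_weight_one]
    omega

theorem IsHomogeneous.isWeightedHomogeneous_two {F : MvPolynomial (Fin 4) ℂ} {n : ℕ} {c : ℤ}
    (h : F.IsHomogeneous n) (hc : c = 2 * n) :
    IsWeightedHomogeneous (fun _ => (2 : ℤ)) F c := by
  intro m hm
  rw [weight_const_two, hc]
  have := h hm
  rw [Pi.one_def, ← Finsupp.degree_eq_weight_one] at this
  omega

attribute [local instance] MvPolynomial.gradedAlgebra

theorem pfIdeal_isHomogeneous {k : ℕ} {β : Fin k → Fin (2*k) → ℤ} {G : MatTuple k}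
    (hG : SkewOfDegrees β G) (S : Fin k → Set (Fin (2*k))) :
    (pfIdeal S G).IsHomogeneous (homogeneousSubmodule (Fin 4) ℂ) := by
  refine Ideal.homogeneous_span _ _ ?_
  rintro f ⟨i, e, -, -, rfl⟩
  exact exists_isHomogeneous_of_isWeightedHomogeneous
    (pfaff_isWeightedHomogeneous _ (fun j => β i (e j)) _ fun a b => (hG i).2 _ _)

theorem span_X_isHomogeneous (W : Set (Fin 4)) :
    (Ideal.span ((X : Fin 4 → MvPolynomial (Fin 4) ℂ) '' W)).IsHomogeneous
      (homogeneousSubmodule (Fin 4) ℂ) := by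
  refine Ideal.homogeneous_span _ _ ?_
  rintro f ⟨v, -, rfl⟩
  exact ⟨1, isHomogeneous_X _ _⟩

/-! ### Openness -/

theorem exists_polyValued_of_mem {k : ℕ} (E : Ideal (MvPolynomial (Fin 4) ℂ))
    (S : Fin k → Set (Fin (2*k))) (G₀ : MatTuple k) {F : MvPolynomial (Fin 4) ℂ}
    (hF : F ∈ E ⊔ pfIdeal S G₀) :
    ∃ Φ ∈ polyValued k, (∀ G, Φ G ∈ E ⊔ pfIdeal S G) ∧ Φ G₀ = F := by
  obtain ⟨f, hf, g, hg, rfl⟩ := Submodule.mem_sup.mp hF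
  suffices h : ∃ Φ ∈ polyValued k, (∀ G, Φ G ∈ E ⊔ pfIdeal S G) ∧ Φ G₀ = g by
    obtain ⟨Φ, hΦ, hΦm, rfl⟩ := h
    exact ⟨algebraMap _ _ f + Φ, add_mem (Subalgebra.algebraMap_mem _ _) hΦ,
      fun G => add_mem (Ideal.mem_sup_left hf) (hΦm G), rfl⟩
  clear hF
  induction hg using Submodule.span_induction with
  | mem x hx =>
    obtain ⟨i, e, he, hS, rfl⟩ := hx
    exact ⟨_, pfaff_mem_polyValued i e,
      fun G => Ideal.mem_sup_right (Ideal.subset_span ⟨i, e, he, hS, rfl⟩), rfl⟩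
  | zero => exact ⟨0, zero_mem _, fun G => zero_mem _, rfl⟩
  | add x y _ _ hx hy =>
    obtain ⟨Φ, hΦ, hΦm, rfl⟩ := hx
    obtain ⟨Ψ, hΨ, hΨm, rfl⟩ := hy
    exact ⟨Φ + Ψ, add_mem hΦ hΨ, fun G => add_mem (hΦm G) (hΨm G), rfl⟩
  | smul c x _ hx =>
    obtain ⟨Φ, hΦ, hΦm, rfl⟩ := hx
    exact ⟨c • Φ, Subalgebra.smul_mem _ hΦ c, fun G => Ideal.mul_mem_left _ c (hΦm G), rfl⟩

theorem Fills.exists_open {k : ℕ} {E : Ideal (MvPolynomial (Fin 4) ℂ)}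
    {S : Fin k → Set (Fin (2*k))} {t : ℕ} {G₀ : MatTuple k}
    (hE : E.IsHomogeneous (homogeneousSubmodule (Fin 4) ℂ))
    (h : Fills (E ⊔ pfIdeal S G₀) t) :
    ∃ P, eval G₀.coeffs P ≠ 0 ∧ ∀ β (G : MatTuple k), SkewOfDegrees β G → eval G.coeffs P ≠ 0 →
      Fills (E ⊔ pfIdeal S G) t := by
  classical
  let ι := {m : Fin 4 →₀ ℕ // m.degree = t}
  have : Finite ι := Set.Finite.to_subtype (by
    have := Finsupp.finite_of_degree_le (σ := Fin 4) t
    exact this.subset fun m (hm : m.degree = t) => hm.le)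
  have : Fintype ι := Fintype.ofFinite ι
  choose Φ hΦ hmem hΦ₀ using fun m : ι => exists_polyValued_of_mem E S G₀
    (h (monomial m.1 1) (isHomogeneous_monomial _ m.2))
  let M : MatTuple k → Matrix ι ι ℂ := fun G => Matrix.of fun m m' => coeff m'.1 (Φ m G)
  have hdet : (fun G => (M G).det) ∈ polyFun k := by
    have : (fun G => (M G).det) = ∑ p : Equiv.Perm ι, (Equiv.Perm.sign p : ℤ) •
        ∏ m, fun G => coeff m.1 (Φ (p m) G) := by
      ext G
      simp [Matrix.det_apply, M, Units.smul_def]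
    rw [this]
    exact sum_mem fun p _ => zsmul_mem (prod_mem fun m _ => hΦ _ _) _
  obtain ⟨P, hP⟩ := mem_polyFun.mp hdet
  refine ⟨P, ?_, fun β G hG hPG F hF => ?_⟩
  · have : M G₀ = 1 := by
      ext m m'
      simp only [M, hΦ₀, coeff_monomial, Matrix.one_apply, Matrix.of_apply]
      exact if_congr Subtype.ext_iff.symm rfl rfl
    rw [hP, this, Matrix.det_one]
    exact one_ne_zero
  · rw [hP] at hPG
    let c : ι → ℂ := fun m => coeff m.1 F
    let v := Matrix.vecMul c (M G)⁻¹
    have hv : Matrix.vecMul v (M G) = c := by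
      rw [Matrix.vecMul_vecMul, Matrix.nonsing_inv_mul _ (isUnit_iff_ne_zero.mpr hPG),
        Matrix.vecMul_one]
    have hFeq : F = homogeneousComponent t (∑ m, C (v m) * Φ m G) := by
      ext m
      rw [coeff_homogeneousComponent]
      split_ifs with hm
      · have := congrFun hv ⟨m, hm⟩
        simp only [Matrix.vecMul, dotProduct, M, Matrix.of_apply, c] at this
        rw [← this, coeff_sum]
        simp
      · exact hF.coeff_eq_zero hm
    rw [hFeq]
    exact homogeneousComponent_mem_of_mem (hE.sup (pfIdeal_isHomogeneous hG S))
      (Ideal.sum_mem _ fun m _ => Ideal.mul_mem_left _ _ (hmem m G)) t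

theorem SkewOfDegrees.line {k : ℕ} {β : Fin k → Fin (2*k) → ℤ} {G₀ G₁ : MatTuple k}
    (h₀ : SkewOfDegrees β G₀) (h₁ : SkewOfDegrees β G₁) (s : ℂ) :
    SkewOfDegrees β (G₀ + s • (G₁ - G₀)) := by
  refine fun i => ⟨fun a b => ?_, fun a b => ?_⟩
  · simp only [Pi.add_apply, Pi.smul_apply, Pi.sub_apply, Matrix.add_apply, Matrix.smul_apply,
      Matrix.sub_apply, (h₀ i).1 a b, (h₁ i).1 a b, smul_sub, smul_neg]
    ring
  · have e₀ := (h₀ i).2 a b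
    have e₁ := (h₁ i).2 a b
    rw [← mem_weightedHomogeneousSubmodule] at *
    exact add_mem e₀ (Submodule.smul_mem _ _ (sub_mem e₁ e₀))

theorem exists_polynomial_eval_line {k : ℕ} (G₀ G₁ : MatTuple k)
    (P : MvPolynomial (Fin k × Fin (2*k) × Fin (2*k) × ((Fin 4) →₀ ℕ)) ℂ) :
    ∃ p : Polynomial ℂ, ∀ s, p.eval s = eval (MatTuple.coeffs (G₀ + s • (G₁ - G₀))) P := by
  refine ⟨aeval (fun x => Polynomial.C (G₀.coeffs x) +
    Polynomial.X * Polynomial.C (G₁.coeffs x - G₀.coeffs x)) P, fun s => ?_⟩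
  rw [← Polynomial.coe_aeval_eq_eval, comp_aeval_apply, aeval_eq_eval]
  congr 2
  ext x
  simp [MatTuple.coeffs]

/-- Two open conditions on the tuples of skew-symmetric matrices of given degrees that can be
satisfied separately can be satisfied together. -/
theorem exists_fills_and_fills {k : ℕ} {β : Fin k → Fin (2*k) → ℤ} {G₀ G₁ : MatTuple k}
    (h₀ : SkewOfDegrees β G₀) (h₁ : SkewOfDegrees β G₁)
    {E₀ E₁ : Ideal (MvPolynomial (Fin 4) ℂ)}
    (hE₀ : E₀.IsHomogeneous (homogeneousSubmodule (Fin 4) ℂ))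
    (hE₁ : E₁.IsHomogeneous (homogeneousSubmodule (Fin 4) ℂ))
    {S₀ S₁ : Fin k → Set (Fin (2*k))} {t₀ t₁ : ℕ}
    (hf₀ : Fills (E₀ ⊔ pfIdeal S₀ G₀) t₀) (hf₁ : Fills (E₁ ⊔ pfIdeal S₁ G₁) t₁) :
    ∃ G, SkewOfDegrees β G ∧ Fills (E₀ ⊔ pfIdeal S₀ G) t₀ ∧ Fills (E₁ ⊔ pfIdeal S₁ G) t₁ := by
  obtain ⟨P₀, hP₀, hP₀'⟩ := hf₀.exists_open hE₀
  obtain ⟨P₁, hP₁, hP₁'⟩ := hf₁.exists_open hE₁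
  obtain ⟨p₀, hp₀⟩ := exists_polynomial_eval_line G₀ G₁ P₀
  obtain ⟨p₁, hp₁⟩ := exists_polynomial_eval_line G₀ G₁ P₁
  have hne₀ : p₀ ≠ 0 := by
    rintro rfl
    have := hp₀ 0
    simp only [Polynomial.eval_zero, zero_smul, add_zero] at this
    exact hP₀ this.symm
  have hne₁ : p₁ ≠ 0 := by
    rintro rfl
    have := hp₁ 1
    simp only [Polynomial.eval_zero, one_smul, add_sub_cancel] at this
    exact hP₁ this.symm
  obtain ⟨s, hs⟩ : ∃ s, (p₀ * p₁).eval s ≠ 0 := by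
    by_contra! h
    exact mul_ne_zero hne₀ hne₁ (Polynomial.funext fun s => by simpa using h s)
  rw [Polynomial.eval_mul, hp₀, hp₁] at hs
  have hG := h₀.line h₁ s
  exact ⟨_, hG, hP₀' _ _ hG (left_ne_zero_of_mul hs), hP₁' _ _ hG (right_ne_zero_of_mul hs)⟩

/-! ### Multiplying a row and a column by a variable -/

/-- Multiply the row and the column with index `q i` of each matrix `G i` by the variable `v`. -/
noncomputable def MatTuple.scaleAt {k : ℕ} (v : Fin 4) (q : Fin k → Fin (2*k)) (G : MatTuple k) :
    MatTuple k := fun i => Matrix.of fun a b =>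
  (if a = q i then X v else 1) * G i a b * (if b = q i then X v else 1)

theorem SkewOfDegrees.scaleAt {k : ℕ} {β β' : Fin k → Fin (2*k) → ℤ} {G : MatTuple k} {v : Fin 4}
    {q : Fin k → Fin (2*k)} (hG : SkewOfDegrees β' G)
    (hβ : ∀ i a, β' i a = β i a - if a = q i then 2 else 0) :
    SkewOfDegrees β (G.scaleAt v q) := by
  have hd : ∀ i a, IsWeightedHomogeneous (fun _ => (2 : ℤ))
      (if a = q i then X v else 1 : MvPolynomial (Fin 4) ℂ) (if a = q i then 2 else 0) := by
    intro i a
    split_ifs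
    · exact isWeightedHomogeneous_X _ _ v
    · exact isWeightedHomogeneous_one _ _
  refine fun i => ⟨fun a b => ?_, fun a b => ?_⟩
  · simp only [MatTuple.scaleAt, Matrix.of_apply, (hG i).1 a b]
    ring
  · have h := ((hd i a).mul ((hG i).2 a b)).mul (hd i b)
    rw [hβ, hβ] at h
    convert h using 1
    · rfl
    · ring

theorem pfaff_scaleAt {k n : ℕ} (v : Fin 4) (q : Fin k → Fin (2*k)) (G : MatTuple k) (i : Fin k)
    {e : Fin (2*n) → Fin (2*k)} (he : Function.Injective e) :
    (q i ∈ Set.range e → pfaff ((G.scaleAt v q i).submatrix e e) =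
      X v * pfaff ((G i).submatrix e e)) ∧
    (q i ∉ Set.range e → pfaff ((G.scaleAt v q i).submatrix e e) =
      pfaff ((G i).submatrix e e)) := by
  have h : pfaff ((G.scaleAt v q i).submatrix e e) =
      (∏ j, if e j = q i then X v else 1) * pfaff ((G i).submatrix e e) :=
    pfaff_scale ((G i).submatrix e e) fun j => if e j = q i then X v else 1
  rw [h]
  constructor
  · rintro ⟨j, hj⟩
    congr 1
    rw [Finset.prod_eq_single j, if_pos hj]
    · exact fun l _ hl => if_neg fun h' => hl (he (h'.trans hj.symm))
    · simp
  · intro hq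
    rw [Finset.prod_eq_one, one_mul]
    exact fun j _ => if_neg fun h' => hq ⟨j, h'⟩

theorem homogeneousComponent_succ_X_mul (v : Fin 4) (H : MvPolynomial (Fin 4) ℂ) (t : ℕ) :
    homogeneousComponent (t + 1) (X v * H) = X v * homogeneousComponent t H := by
  ext m
  rw [coeff_homogeneousComponent, coeff_X_mul', coeff_X_mul', coeff_homogeneousComponent]
  by_cases hv : v ∈ m.support
  · have hm : m.degree = (m - Finsupp.single v 1).degree + 1 := by
      have hle : Finsupp.single v 1 ≤ m := by
        rw [Finsupp.single_le_iff]
        exact Nat.one_le_iff_ne_zero.mpr (Finsupp.mem_support_iff.mp hv)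
      conv_lhs => rw [← tsub_add_cancel_of_le hle]
      simp
    simp [hv, hm]
  · simp [hv]

theorem Fills.scaleAt {k : ℕ} {β : Fin k → Fin (2*k) → ℤ} {G : MatTuple k}
    (hG : SkewOfDegrees β G) {v : Fin 4} {W : Set (Fin 4)} {q : Fin k → Fin (2*k)}
    {S : Fin k → Set (Fin (2*k))} {t : ℕ}
    (h : Fills (Ideal.span (X '' W) ⊔ pfIdeal S G) t)
    (h' : Fills (Ideal.span (X '' insert v W) ⊔ pfIdeal (fun i => insert (q i) (S i)) G) (t + 1)) :
    Fills (Ideal.span (X '' W) ⊔ pfIdeal S (G.scaleAt v q)) (t + 1) := by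
  have hmul : ∀ g ∈ pfIdeal S G, X v * g ∈ pfIdeal S (G.scaleAt v q) := by
    intro g hg
    induction hg using Submodule.span_induction with
    | mem x hx =>
      obtain ⟨i, e, he, hS, rfl⟩ := hx
      have hmem : pfaff ((G.scaleAt v q i).submatrix e e) ∈ pfIdeal S (G.scaleAt v q) :=
        Ideal.subset_span ⟨i, e, he, hS, rfl⟩
      by_cases hq : q i ∈ Set.range e
      · rwa [← (pfaff_scaleAt v q G i he).1 hq]
      · rw [← (pfaff_scaleAt v q G i he).2 hq]
        exact Ideal.mul_mem_left _ _ hmem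
    | zero => simp
    | add x y _ _ hx hy => rw [mul_add]; exact add_mem hx hy
    | smul c x _ hx => rw [smul_eq_mul, mul_left_comm]; exact Ideal.mul_mem_left _ _ hx
  have hle : pfIdeal (fun i => insert (q i) (S i)) G ≤ pfIdeal S (G.scaleAt v q) := by
    refine Ideal.span_le.mpr ?_
    rintro _ ⟨i, e, he, hS, rfl⟩
    refine Ideal.subset_span ⟨i, e, he, fun j hj => hS j (Or.inr hj), ?_⟩
    refine ((pfaff_scaleAt v q G i he).2 ?_).symm
    rintro ⟨j, hj⟩
    exact hS j (Or.inl hj)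
  intro F hF
  have hF' := h' F hF
  rw [Set.image_insert_eq, Ideal.span_insert, sup_assoc] at hF'
  obtain ⟨g, hg, r, hr, hgr⟩ := Submodule.mem_sup.mp hF'
  obtain ⟨H, rfl⟩ := Ideal.mem_span_singleton.mp hg
  have hdecomp : F = X v * homogeneousComponent t H + homogeneousComponent (t + 1) r := by
    rw [← homogeneousComponent_succ_X_mul, ← map_add, hgr, homogeneousComponent_eq_self hF]
  rw [hdecomp]
  refine add_mem ?_ ?_
  · obtain ⟨g, hg, f, hf, hgf⟩ := Submodule.mem_sup.mp
      (h _ (homogeneousComponent_isHomogeneous t H))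
    rw [← hgf, mul_add]
    exact add_mem (Ideal.mem_sup_left (Ideal.mul_mem_left _ _ hg))
      (Ideal.mem_sup_right (hmul f hf))
  · exact sup_le_sup_left hle _ (homogeneousComponent_mem_of_mem
      ((span_X_isHomogeneous W).sup (pfIdeal_isHomogeneous hG _)) hr _)

/-- Erase the entries in the row and in the column with index `p i` of each matrix `G i`. -/
noncomputable def MatTuple.eraseAt {k : ℕ} (p : Fin k → Fin (2*k)) (G : MatTuple k) :
    MatTuple k := fun i => Matrix.of fun a b => if a = p i ∨ b = p i then 0 else G i a b

theorem SkewOfDegrees.eraseAt {k : ℕ} {β β' : Fin k → Fin (2*k) → ℤ} {G : MatTuple k}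
    {p : Fin k → Fin (2*k)} (hG : SkewOfDegrees β G) (hβ : ∀ i a, a ≠ p i → β' i a = β i a) :
    SkewOfDegrees β' (G.eraseAt p) := by
  refine fun i => ⟨fun a b => ?_, fun a b => ?_⟩
  · simp only [MatTuple.eraseAt, Matrix.of_apply, (hG i).1 a b, or_comm (a := b = p i)]
    split_ifs <;> simp
  · simp only [MatTuple.eraseAt, Matrix.of_apply]
    split_ifs with h
    · exact isWeightedHomogeneous_zero _ _ _
    · rw [not_or] at h
      rw [hβ i a h.1, hβ i b h.2]
      exact (hG i).2 a b

theorem pfIdeal_eraseAt {k : ℕ} (p : Fin k → Fin (2*k)) (G : MatTuple k) :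
    pfIdeal (fun i => {p i}) (G.eraseAt p) = pfIdeal (fun i => {p i}) G := by
  have h : ∀ i (e : Fin (2*(k-1)) → Fin (2*k)), (∀ j, e j ∉ ({p i} : Set (Fin (2*k)))) →
      (G.eraseAt p i).submatrix e e = (G i).submatrix e e := by
    intro i e he
    ext1 a b
    exact if_neg (not_or.mpr ⟨he a, he b⟩)
  unfold pfIdeal
  congr 1
  ext f
  refine exists_congr fun i => exists_congr fun e => and_congr_right fun _ =>
    and_congr_right fun he => ?_
  rw [h i e he]

/-! ### Matchings -/

/-- The degree of the `(a, b)` entry of a matrix being `(γ a + γ b) / 2`, these are conditions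
under which there are perfect matchings of the complement of any two indexes by entries of
non-negative degree. -/
structure BalancedDegrees (k : ℕ) (γ : Fin (2*k) → ℤ) : Prop where
  even_sub : ∀ a b, 2 ∣ γ a - γ b
  neg_one_le : ∀ a, -1 ≤ γ a
  card_neg_le : (Finset.univ.filter (γ · < 0)).card ≤ k - 1

theorem BalancedDegrees.exists_pairing {k : ℕ} {γ : Fin (2*k) → ℤ} (h : BalancedDegrees k γ)
    {p q : Fin (2*k)} (hpq : p ≠ q) :
    ∃ n : Fin (k-1) × Fin 2 → Fin (2*k), Function.Injective n ∧ (∀ x, n x ≠ p ∧ n x ≠ q) ∧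
      ∃ D : Fin (k-1) → ℕ, (∀ i, γ (n (i, 0)) + γ (n (i, 1)) = 2 * D i) ∧
        ∑ a, γ a = γ p + γ q + 2 * ∑ i, (D i : ℤ) := by
  classical
  let T : Finset (Fin (2*k)) := Finset.univ \ {p, q}
  have hT : T.card = 2 * (k - 1) := by
    rw [Finset.card_sdiff_of_subset (Finset.subset_univ _), Finset.card_pair hpq,
      Finset.card_univ, Fintype.card_fin]
    omega
  obtain ⟨N, hN1, hN2, hN⟩ := Finset.exists_subsuperset_card_eq
    (s := T.filter (γ · < 0)) (t := T) (n := k - 1) (Finset.filter_subset _ _)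
    ((Finset.card_le_card (Finset.filter_subset_filter _ (Finset.subset_univ _))).trans
      h.card_neg_le) (by omega)
  have hP : (T \ N).card = k - 1 := by
    rw [Finset.card_sdiff_of_subset hN2]; omega
  have hPmem := fun i => Finset.mem_sdiff.mp (Finset.orderEmbOfFin_mem (T \ N) hP i)
  have hNmem := Finset.orderEmbOfFin_mem N hN
  have hTne : ∀ a ∈ T, a ≠ p ∧ a ≠ q := fun a ha => by simpa [T] using ha
  have hnn : ∀ i, 0 ≤ γ ((T \ N).orderEmbOfFin hP i) := fun i => by
    by_contra! hlt
    exact (hPmem i).2 (hN1 (Finset.mem_filter.mpr ⟨(hPmem i).1, hlt⟩))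
  have hD : ∀ i, ∃ d : ℕ,
      γ (N.orderEmbOfFin hN i) + γ ((T \ N).orderEmbOfFin hP i) = 2 * d := fun i => by
    have h1 := h.even_sub (N.orderEmbOfFin hN i) ((T \ N).orderEmbOfFin hP i)
    have h2 := hnn i
    have h3 := h.neg_one_le (N.orderEmbOfFin hN i)
    exact ⟨((γ (N.orderEmbOfFin hN i) + γ ((T \ N).orderEmbOfFin hP i)) / 2).toNat, by omega⟩
  choose D hD using hD
  refine ⟨fun x => if x.2 = 0 then N.orderEmbOfFin hN x.1 else (T \ N).orderEmbOfFin hP x.1,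
    ?_, ?_, D, hD, ?_⟩
  · rintro ⟨i, s⟩ ⟨j, s'⟩ hij
    dsimp only at hij
    split_ifs at hij with h1 h2 h2
    · simpa [h1, h2] using hij
    · exact absurd (hij ▸ hNmem i) (hPmem j).2
    · exact absurd (hij ▸ hNmem j) (hPmem i).2
    · have := ((T \ N).orderEmbOfFin hP).injective hij
      ext <;> simp only [this]
      omega
  · rintro ⟨i, s⟩
    dsimp only
    split_ifs
    · exact hTne _ (hN2 (hNmem i))
    · exact hTne _ (hPmem i).1
  · have hsum : ∀ (Q : Finset (Fin (2*k))) (hQ : Q.card = k - 1),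
        ∑ i, γ (Q.orderEmbOfFin hQ i) = ∑ a ∈ Q, γ a := fun Q hQ => by
      conv_rhs => rw [← Finset.map_orderEmbOfFin_univ Q hQ, Finset.sum_map]
      rfl
    rw [Finset.mul_sum, ← Finset.sum_congr rfl fun i _ => hD i, Finset.sum_add_distrib, hsum,
      hsum, add_comm (∑ a ∈ N, γ a), Finset.sum_sdiff hN2, ← Finset.sum_pair hpq,
      add_comm, Finset.sum_sdiff (Finset.subset_univ _)]

theorem exists_le_sum_eq {ι : Type*} (s : Finset ι) (D : ι → ℕ) {α : ℕ} (hα : α ≤ ∑ i ∈ s, D i) :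
    ∃ x : ι → ℕ, (∀ i, x i ≤ D i) ∧ ∑ i ∈ s, x i = α := by
  classical
  induction s using Finset.induction_on generalizing α with
  | empty => exact ⟨0, fun i => Nat.zero_le _, by simpa using (hα.antisymm (Nat.zero_le _)).symm⟩
  | insert j s hj ih =>
    rw [Finset.sum_insert hj] at hα
    obtain ⟨x, hx, hxs⟩ := ih (α := α - min α (D j)) (by omega)
    refine ⟨Function.update x j (min α (D j)), fun i => ?_, ?_⟩
    · by_cases hij : i = j
      · subst hij; simp
      · simpa [hij] using hx i
    · rw [Finset.sum_insert hj, Function.update_self,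
        Finset.sum_congr rfl fun i hi => Function.update_of_ne (ne_of_mem_of_not_mem hi hj) _ _]
      omega

/-- The skew-symmetric block diagonal matrix whose blocks have off-diagonal entries `± f i`. -/
def pairingMatrix {n : ℕ} {R : Type*} [Ring R] (f : Fin n → R) :
    Matrix (Fin n × Fin 2) (Fin n × Fin 2) R :=
  Matrix.of fun x y => if x.1 = y.1 then
    if x.2 = y.2 then 0 else if x.2 = 0 then f x.1 else - f x.1 else 0

theorem isSkew_pairingMatrix {n : ℕ} {R : Type*} [Ring R] (f : Fin n → R) :
    IsSkew (pairingMatrix f) := by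
  rintro ⟨i, s⟩ ⟨j, s'⟩
  by_cases hij : i = j
  · subst hij
    fin_cases s <;> fin_cases s' <;> simp [pairingMatrix]
  · simp [pairingMatrix, hij, Ne.symm hij]

theorem BalancedDegrees.exists_matching {k : ℕ} {γ : Fin (2*k) → ℤ} (h : BalancedDegrees k γ)
    {p q : Fin (2*k)} (hpq : p ≠ q) {α ρ : ℕ}
    (hsum : ∑ a, γ a = γ p + γ q + 2 * (α + ρ : ℕ)) :
    ∃ M : Matrix (Fin (2*k)) (Fin (2*k)) (MvPolynomial (Fin 4) ℂ), IsSkew M ∧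
      (∀ a b, IsWeightedHomogeneous (fun _ => (2 : ℤ)) (M a b) (γ a + γ b)) ∧
      ∃ e : Fin (2*(k-1)) → Fin (2*k), Function.Injective e ∧ (∀ j, e j ≠ p ∧ e j ≠ q) ∧
        ∃ c : ℂ, c ≠ 0 ∧ pfaff (M.submatrix e e) = c • (X 0 ^ α * X 1 ^ ρ) := by
  classical
  obtain ⟨n, hn, hnpq, D, hD, hDsum⟩ := h.exists_pairing hpq
  have hDsum' : ∑ i, D i = α + ρ := by
    rw [hsum] at hDsum
    zify
    push_cast at hDsum
    linarith
  obtain ⟨x, hx, hxsum⟩ := exists_le_sum_eq Finset.univ D (α := α) (by omega)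
  let f : Fin (k-1) → MvPolynomial (Fin 4) ℂ := fun i => X 0 ^ x i * X 1 ^ (D i - x i)
  have hf : ∀ i, IsWeightedHomogeneous (fun _ => (2 : ℤ)) (f i) (2 * D i) := fun i => by
    refine IsHomogeneous.isWeightedHomogeneous_two (n := x i + (D i - x i))
      ((isHomogeneous_X_pow _ _).mul (isHomogeneous_X_pow _ _)) ?_
    rw [Nat.add_sub_cancel' (hx i)]
  let K := pairingMatrix f
  let M : Matrix (Fin (2*k)) (Fin (2*k)) (MvPolynomial (Fin 4) ℂ) :=
    Matrix.of fun a b => Function.extend n (fun y => Function.extend n (K y) 0 b) 0 a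
  have hM : ∀ y z, M (n y) (n z) = K y z := fun y z => by
    simp [M, hn.extend_apply]
  have hM0 : ∀ a b, (¬ ∃ y z, n y = a ∧ n z = b) → M a b = 0 := fun a b hab => by
    by_cases ha : ∃ y, n y = a
    · obtain ⟨y, rfl⟩ := ha
      have hb : ¬ ∃ z, n z = b := fun ⟨z, hz⟩ => hab ⟨y, z, rfl, hz⟩
      simp [M, hn.extend_apply, Function.extend_apply' _ _ _ hb]
    · simp [M, Function.extend_apply' _ _ _ ha]
  refine ⟨M, fun a b => ?_, fun a b => ?_, n ∘ (pairEquiv (k-1)).symm,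
    hn.comp (Equiv.injective _), fun j => hnpq _, ?_⟩
  · by_cases hab : ∃ y z, n y = a ∧ n z = b
    · obtain ⟨y, z, rfl, rfl⟩ := hab
      rw [hM, hM]
      exact isSkew_pairingMatrix f y z
    · rw [hM0 a b hab, hM0 b a fun ⟨y, z, h1, h2⟩ => hab ⟨z, y, h2, h1⟩, neg_zero]
  · by_cases hab : ∃ y z, n y = a ∧ n z = b
    · obtain ⟨⟨i, s⟩, ⟨j, s'⟩, rfl, rfl⟩ := hab
      rw [hM]
      by_cases hij : i = j
      · subst hij
        have h1 := hf i
        rw [← hD i] at h1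
        have h2 := (weightedHomogeneousSubmodule ℂ (fun _ => (2 : ℤ)) _).neg_mem h1
        rw [mem_weightedHomogeneousSubmodule, add_comm] at h2
        fin_cases s <;> fin_cases s' <;>
          simp [K, pairingMatrix, isWeightedHomogeneous_zero, h1, h2]
      · simp [K, pairingMatrix, hij, isWeightedHomogeneous_zero]
    · rw [hM0 a b hab]
      exact isWeightedHomogeneous_zero _ _ _
  · obtain ⟨c, hc, hpf⟩ := exists_pfaff_eq_smul_prod f
      (M.submatrix (n ∘ (pairEquiv (k-1)).symm) (n ∘ (pairEquiv (k-1)).symm))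
      (fun i => by simp [hM, K, pairingMatrix]) (fun i => by simp [hM, K, pairingMatrix])
      (fun i j s s' hij => by simp [hM, K, pairingMatrix, hij])
    refine ⟨c, hc, hpf.trans ?_⟩
    congr 1
    rw [Finset.prod_mul_distrib, Finset.prod_pow_eq_pow_sum, Finset.prod_pow_eq_pow_sum, hxsum]
    congr 2
    have := Finset.sum_tsub_distrib Finset.univ (f := D) (g := x) fun i _ => hx i
    omega

theorem BalancedDegrees.exists_second_max {k : ℕ} {γ : Fin (2*k) → ℤ} (h : BalancedDegrees k γ)
    {p : Fin (2*k)} (hp : ∀ a, γ a ≤ γ p) {t : ℕ} (ht : ∑ a, γ a = 2 * t) :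
    ∃ q, p ≠ q ∧ (∀ a, a ≠ p → γ a ≤ γ q) ∧ ∃ δ : ℕ, ∑ a, γ a = γ p + γ q + 2 * δ ∧
      δ ≤ t ∧ t ≤ k * (t - δ) := by
  classical
  have hk : 0 < k := by have := p.2; omega
  have hne : (Finset.univ.erase p).Nonempty := by
    rw [← Finset.card_pos, Finset.card_erase_of_mem (Finset.mem_univ _), Finset.card_univ,
      Fintype.card_fin]
    omega
  obtain ⟨q, hq, hqmax⟩ := Finset.exists_max_image _ γ hne
  have hpq : p ≠ q := (Finset.ne_of_mem_erase hq).symm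
  have hqmax' : ∀ a, a ≠ p → γ a ≤ γ q := fun a ha => hqmax a (by simp [ha])
  obtain ⟨-, -, -, D, -, hD⟩ := h.exists_pairing hpq
  have hle : ∑ a, γ a ≤ ∑ a, (γ q + if a = p then γ p - γ q else 0) := by
    refine Finset.sum_le_sum fun a _ => ?_
    split_ifs with ha
    · subst ha; linarith
    · linarith [hqmax' a ha]
  rw [Finset.sum_add_distrib, Finset.sum_ite_eq' Finset.univ p, if_pos (Finset.mem_univ _),
    Finset.sum_const, Finset.card_univ, Fintype.card_fin, nsmul_eq_mul] at hle
  push_cast at hle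
  rw [← Nat.cast_sum] at hD
  set δ := ∑ i, D i
  have hpq' := hp q
  have hk' : (1 : ℤ) ≤ k := by exact_mod_cast hk
  have key : (δ : ℤ) ≤ (k - 1) * (t - δ) := by nlinarith
  have hδ : δ ≤ t := by
    by_contra! hlt
    have h1 : (t : ℤ) + 1 ≤ δ := by exact_mod_cast hlt
    nlinarith
  refine ⟨q, hpq, hqmax', δ, hD, hδ, ?_⟩
  zify [hδ]
  linarith

theorem BalancedDegrees.sub {k : ℕ} {γ : Fin (2*k) → ℤ} (h : BalancedDegrees k γ)
    {p q : Fin (2*k)} (hpq : p ≠ q) (hp : γ q ≤ γ p) (hq : ∀ a, a ≠ p → γ a ≤ γ q) {δ : ℕ}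
    (hδ : 0 < δ) (hsum : ∑ a, γ a = γ p + γ q + 2 * δ) {x : Fin (2*k)} (hx : x = p ∨ x = q) :
    BalancedDegrees k fun a => γ a - if a = x then 2 else 0 := by
  classical
  have hδ' : (1 : ℤ) ≤ δ := by exact_mod_cast hδ
  have hq1 : 1 ≤ γ q := by
    by_contra! hlt
    have hle : ∑ a, γ a ≤ ∑ a, ((if a = p then γ p else 0) + if a = q then γ q else 0) := by
      refine Finset.sum_le_sum fun a _ => ?_
      have := hq a
      split_ifs with h1 h2 h2
      · exact absurd (h1.symm.trans h2) hpq
      · rw [h1, add_zero]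
      · rw [h2, zero_add]
      · linarith [hq a h1]
    rw [Finset.sum_add_distrib, Finset.sum_ite_eq' Finset.univ p,
      Finset.sum_ite_eq' Finset.univ q] at hle
    simp only [Finset.mem_univ, if_true] at hle
    linarith
  have hx1 : 1 ≤ γ x := by rcases hx with rfl | rfl <;> linarith
  refine ⟨fun a b => ?_, fun a => ?_, ?_⟩
  · have := h.even_sub a b
    split_ifs <;> omega
  · have := h.neg_one_le a
    split_ifs with hax
    · subst hax; omega
    · omega
  · by_cases hx2 : 2 ≤ γ x
    · refine (Finset.card_le_card fun a => ?_).trans h.card_neg_le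
      simp only [Finset.mem_filter, Finset.mem_univ, true_and]
      split_ifs with hax
      · subst hax; omega
      · omega
    · have hqx : γ q = 1 := by rcases hx with rfl | rfl <;> omega
      have hsub : Finset.univ.filter (fun a => (γ a - if a = x then 2 else 0) < 0) ⊆
          insert x (Finset.univ.filter (γ · < 0)) := by
        intro a
        simp only [Finset.mem_filter, Finset.mem_univ, true_and, Finset.mem_insert]
        split_ifs with hax
        · exact fun _ => Or.inl hax
        · exact fun h => Or.inr (by omega)
      have hle : ∑ a, γ a ≤
          ∑ a, (1 + (if a = p then γ p - 1 else 0) - 2 * if γ a < 0 then 1 else 0) := by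
        refine Finset.sum_le_sum fun a _ => ?_
        have := hq a
        split_ifs with h1 h2 h2
        · subst h1; omega
        · subst h1; omega
        · omega
        · linarith [hq a h1]
      rw [Finset.sum_sub_distrib, Finset.sum_add_distrib, Finset.sum_ite_eq' Finset.univ p,
        if_pos (Finset.mem_univ _), Finset.sum_const, Finset.card_univ, Fintype.card_fin,
        ← Finset.mul_sum, Finset.sum_boole, nsmul_eq_mul] at hle
      push_cast at hle
      have h1 := (Finset.card_le_card hsub).trans (Finset.card_insert_le _ _)
      omega

/-! ### Filling the polynomial ring -/

theorem fills_of_monomial_mem {I : Ideal (MvPolynomial (Fin 4) ℂ)} {t : ℕ}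
    (h : ∀ m : Fin 4 → ℕ, m 0 + m 1 + m 2 + m 3 = t →
      (X 0 ^ m 0 * X 1 ^ m 1 * X 2 ^ m 2 * X 3 ^ m 3 : MvPolynomial (Fin 4) ℂ) ∈ I) :
    Fills I t := by
  intro F hF
  rw [F.as_sum]
  refine Ideal.sum_mem _ fun m hm => ?_
  rw [monomial_eq, Finsupp.prod_fintype _ _ (by simp), Fin.prod_univ_four]
  refine Ideal.mul_mem_left _ _ (h m ?_)
  have := hF (mem_support_iff.mp hm)
  rw [Pi.one_def, ← Finsupp.degree_eq_weight_one] at this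
  rw [← this, Finsupp.degree_eq_sum, Fin.sum_univ_four]

theorem mem_pfIdeal_of_pfaff_eq_smul {k : ℕ} {S : Fin k → Set (Fin (2*k))} {G : MatTuple k}
    {i : Fin k} {e : Fin (2*(k-1)) → Fin (2*k)} (he : Function.Injective e)
    (hS : ∀ j, e j ∉ S i) {c : ℂ} (hc : c ≠ 0) {f : MvPolynomial (Fin 4) ℂ}
    (h : pfaff ((G i).submatrix e e) = c • f) : f ∈ pfIdeal S G := by
  have : f = C c⁻¹ * pfaff ((G i).submatrix e e) := by
    rw [h, C_mul', smul_smul, inv_mul_cancel₀ hc, one_smul]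
  rw [this]
  exact Ideal.mul_mem_left _ _ (Ideal.subset_span ⟨i, e, he, hS, rfl⟩)

theorem exists_pfIdeal_eq_top {k : ℕ} {β : Fin k → Fin (2*k) → ℤ} (i : Fin k)
    (h : BalancedDegrees k (β i)) {p q : Fin (2*k)} (hpq : p ≠ q)
    (hsum : ∑ a, β i a = β i p + β i q) :
    ∃ G, SkewOfDegrees β G ∧ ∀ S : Fin k → Set (Fin (2*k)), S i ⊆ {p, q} → pfIdeal S G = ⊤ := by
  classical
  obtain ⟨M, hM, hMdeg, e, he, hepq, c, hc, hpf⟩ :=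
    h.exists_matching hpq (α := 0) (ρ := 0) (by simpa using hsum)
  refine ⟨fun j => if j = i then M else 0, fun j => ?_, fun S hS => ?_⟩
  · dsimp only
    split_ifs with hj
    · subst hj; exact ⟨hM, hMdeg⟩
    · exact ⟨fun a b => by simp, fun a b => isWeightedHomogeneous_zero _ _ _⟩
  · rw [Ideal.eq_top_iff_one]
    refine mem_pfIdeal_of_pfaff_eq_smul (i := i) he (fun j hj => ?_) hc ?_
    · have := hS hj
      simp [hepq j] at this
    · simpa using hpf

theorem exists_index_of_le_mul_sub {k t : ℕ} (hk : 0 < k) {δ : Fin k → ℕ} (hδ : ∀ i, δ i ≤ t)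
    (ht : ∀ i, t ≤ k * (t - δ i)) {r s : ℕ} (hrs : r + s = t) :
    ∃ i : Fin k, min (i * t / k) (δ i) ≤ r ∧ δ i - min (i * t / k) (δ i) ≤ s := by
  have hdiv : ∀ i : Fin k, i * t / k ≤ r → k * r ≤ i * t + t →
      min (i * t / k) (δ i) ≤ r ∧ δ i - min (i * t / k) (δ i) ≤ s := by
    intro i h1 h2
    refine ⟨(min_le_left _ _).trans h1, ?_⟩
    have h3 : δ i - s ≤ i * t / k := by
      rw [Nat.le_div_iff_mul_le hk]
      have h4 := ht i
      have h5 := hδ i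
      by_cases h6 : s ≤ δ i
      · zify [h5, h6] at *
        nlinarith
      · rw [Nat.sub_eq_zero_of_le (by omega), zero_mul]
        exact Nat.zero_le _
    omega
  by_cases hs : s = 0
  · have hr : r = t := by omega
    subst hr
    refine ⟨⟨k - 1, by omega⟩, hdiv _ ?_ ?_⟩
    · exact Nat.div_le_of_le_mul (Nat.mul_le_mul_right _ (Nat.sub_le _ _))
    · dsimp only
      nth_rewrite 1 [show k = k - 1 + 1 by omega]
      rw [add_mul, one_mul]
  · have ht0 : 0 < t := by omega
    refine ⟨⟨k * r / t, ?_⟩, hdiv _ ?_ ?_⟩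
    · rw [Nat.div_lt_iff_lt_mul ht0]
      exact Nat.mul_lt_mul_of_pos_left (by omega) hk
    · exact Nat.div_le_of_le_mul (Nat.div_mul_le_self _ _)
    · exact (Nat.lt_div_mul_add ht0).le

theorem exists_fills_of_two_variables {k : ℕ} (hk : 0 < k) {β : Fin k → Fin (2*k) → ℤ}
    (h : ∀ i, BalancedDegrees k (β i)) {p q : Fin k → Fin (2*k)} (hpq : ∀ i, p i ≠ q i)
    {δ : Fin k → ℕ} (hsum : ∀ i, ∑ a, β i a = β i (p i) + β i (q i) + 2 * δ i) {t : ℕ}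
    (hδ : ∀ i, δ i ≤ t) (ht : ∀ i, t ≤ k * (t - δ i)) :
    ∃ G, SkewOfDegrees β G ∧
      Fills (Ideal.span (X '' insert 2 {3}) ⊔ pfIdeal (fun i => insert (q i) {p i}) G) t := by
  choose M hM hMdeg e he hepq c hc hpf using fun i => (h i).exists_matching (hpq i)
    (α := min (i * t / k) (δ i)) (ρ := δ i - min (i * t / k) (δ i))
    (by rw [hsum, Nat.add_sub_cancel' (min_le_right _ _)])
  refine ⟨M, fun i => ⟨hM i, hMdeg i⟩, fills_of_monomial_mem fun m hm => ?_⟩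
  have hX : ∀ v ∈ (insert 2 {3} : Set (Fin 4)),
      (X v : MvPolynomial (Fin 4) ℂ) ∈ Ideal.span (X '' insert 2 {3}) :=
    fun v hv => Ideal.subset_span (Set.mem_image_of_mem X hv)
  by_cases h2 : m 2 = 0
  · by_cases h3 : m 3 = 0
    · obtain ⟨i, hi1, hi2⟩ := exists_index_of_le_mul_sub hk hδ ht (r := m 0) (s := m 1) (by omega)
      rw [h2, h3, pow_zero, pow_zero, mul_one, mul_one]
      refine Ideal.mem_sup_right (Ideal.mem_of_dvd _
        (mul_dvd_mul (pow_dvd_pow _ hi1) (pow_dvd_pow _ hi2))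
        (mem_pfIdeal_of_pfaff_eq_smul (he i) (fun j hj => ?_) (hc i) (hpf i)))
      simp [hepq i j] at hj
    · exact Ideal.mem_sup_left (Ideal.mul_mem_left _ _ (Ideal.pow_mem_of_mem _
        (hX 3 (by simp)) _ (Nat.pos_of_ne_zero h3)))
  · exact Ideal.mem_sup_left (Ideal.mul_mem_right _ _ (Ideal.mul_mem_left _ _
      (Ideal.pow_mem_of_mem _ (hX 2 (by simp)) _ (Nat.pos_of_ne_zero h2))))

theorem exists_fills_of_three_variables {k : ℕ} (hk : 0 < k) (t : ℕ)
    {β : Fin k → Fin (2*k) → ℤ} (h : ∀ i, BalancedDegrees k (β i)) {p : Fin k → Fin (2*k)}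
    (hp : ∀ i a, β i a ≤ β i (p i)) (ht : ∀ i, ∑ a, β i a = 2 * t) :
    ∃ G, SkewOfDegrees β G ∧ Fills (Ideal.span (X '' {3}) ⊔ pfIdeal (fun i => {p i}) G) t := by
  induction t generalizing β with
  | zero =>
    obtain ⟨q, hpq, -, δ, hsum, hδ, -⟩ := (h ⟨0, hk⟩).exists_second_max (hp _) (ht _)
    obtain rfl : δ = 0 := Nat.le_zero.mp hδ
    obtain ⟨G, hG, hGS⟩ := exists_pfIdeal_eq_top _ (h ⟨0, hk⟩) hpq (by simpa using hsum)
    refine ⟨G, hG, fun F _ => Ideal.mem_sup_right ?_⟩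
    rw [hGS _ (by simp)]
    trivial
  | succ t ih =>
    choose q hpq hq δ hsum hδ htδ using fun i => (h i).exists_second_max (hp i) (ht i)
    by_cases h0 : ∃ i, δ i = 0
    · obtain ⟨i, hi⟩ := h0
      obtain ⟨G, hG, hGS⟩ := exists_pfIdeal_eq_top _ (h i) (hpq i) (by simpa [hi] using hsum i)
      refine ⟨G, hG, fun F _ => Ideal.mem_sup_right ?_⟩
      rw [hGS _ (by simp)]
      trivial
    · have hδ0 : ∀ i, 0 < δ i := fun i => Nat.pos_of_ne_zero fun hi => h0 ⟨i, hi⟩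
      let β' : Fin k → Fin (2*k) → ℤ := fun i a => β i a - if a = q i then 2 else 0
      have hβ' : ∀ i, BalancedDegrees k (β' i) := fun i =>
        (h i).sub (hpq i) (hp i _) (hq i) (hδ0 i) (hsum i) (Or.inr rfl)
      have hβ's : ∀ i, ∑ a, β' i a = ∑ a, β i a - 2 := fun i => by
        simp [β', Finset.sum_sub_distrib]
      have hβ'p : ∀ i, β' i (p i) = β i (p i) := fun i => by simp [β', hpq i]
      obtain ⟨G₀, hG₀, hf₀⟩ := ih hβ' (fun i a => by
          rw [hβ'p]
          have := hp i a
          dsimp only [β']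
          split_ifs <;> omega)
        (fun i => by rw [hβ's, ht]; push_cast; ring)
      obtain ⟨G₁, hG₁, hf₁⟩ := exists_fills_of_two_variables hk hβ' hpq (δ := δ)
        (fun i => by rw [hβ's, hβ'p, hsum]; simp only [β', if_true]; ring) hδ htδ
      obtain ⟨G, hG, hf, hf'⟩ := exists_fills_and_fills hG₀ hG₁ (span_X_isHomogeneous _)
        (span_X_isHomogeneous _) hf₀ hf₁
      exact ⟨_, hG.scaleAt fun i a => rfl, hf.scaleAt hG hf'⟩

theorem exists_fills_of_four_variables {k : ℕ} (hk : 0 < k) (t : ℕ)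
    {β : Fin k → Fin (2*k) → ℤ} (h : ∀ i, BalancedDegrees k (β i))
    (ht : ∀ i, ∑ a, β i a = 2 * t) :
    ∃ G, SkewOfDegrees β G ∧ Fills (Ideal.span (X '' ∅) ⊔ pfIdeal (fun _ => ∅) G) t := by
  have : Nonempty (Fin (2*k)) := ⟨⟨0, by omega⟩⟩
  induction t generalizing β with
  | zero =>
    obtain ⟨p, hp⟩ := Finite.exists_max (β ⟨0, hk⟩)
    obtain ⟨q, hpq, -, δ, hsum, hδ, -⟩ := (h ⟨0, hk⟩).exists_second_max hp (ht _)
    obtain rfl : δ = 0 := Nat.le_zero.mp hδ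
    obtain ⟨G, hG, hGS⟩ := exists_pfIdeal_eq_top _ (h ⟨0, hk⟩) hpq (by simpa using hsum)
    refine ⟨G, hG, fun F _ => Ideal.mem_sup_right ?_⟩
    rw [hGS _ (by simp)]
    trivial
  | succ t ih =>
    choose p hp using fun i => Finite.exists_max (β i)
    choose q hpq hq δ hsum hδ htδ using fun i => (h i).exists_second_max (hp i) (ht i)
    by_cases h0 : ∃ i, δ i = 0
    · obtain ⟨i, hi⟩ := h0
      obtain ⟨G, hG, hGS⟩ := exists_pfIdeal_eq_top _ (h i) (hpq i) (by simpa [hi] using hsum i)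
      refine ⟨G, hG, fun F _ => Ideal.mem_sup_right ?_⟩
      rw [hGS _ (by simp)]
      trivial
    · have hδ0 : ∀ i, 0 < δ i := fun i => Nat.pos_of_ne_zero fun hi => h0 ⟨i, hi⟩
      let β' : Fin k → Fin (2*k) → ℤ := fun i a => β i a - if a = p i then 2 else 0
      have hβ' : ∀ i, BalancedDegrees k (β' i) := fun i =>
        (h i).sub (hpq i) (hp i _) (hq i) (hδ0 i) (hsum i) (Or.inl rfl)
      obtain ⟨G₀, hG₀, hf₀⟩ := ih hβ' fun i => by
        simp only [β', Finset.sum_sub_distrib, Finset.sum_ite_eq', Finset.mem_univ, if_true, ht]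
        push_cast
        ring
      obtain ⟨G₁, hG₁, hf₁⟩ := exists_fills_of_three_variables hk _ h hp ht
      have hG₁' : SkewOfDegrees β' (G₁.eraseAt p) := hG₁.eraseAt fun i a ha => by simp [β', ha]
      rw [← pfIdeal_eraseAt] at hf₁
      obtain ⟨G, hG, hf, hf'⟩ := exists_fills_and_fills hG₀ hG₁' (span_X_isHomogeneous _)
        (span_X_isHomogeneous _) hf₀ hf₁
      refine ⟨_, hG.scaleAt (q := p) (v := 3) fun i a => rfl, hf.scaleAt hG ?_⟩
      simpa only [insert_empty_eq] using hf'

/-! ### Matrices with a homogeneous degree matrix -/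

theorem isHomogeneous_of_isWeightedHomogeneous_two {F : MvPolynomial (Fin 4) ℂ} {n : ℕ} {c : ℤ}
    (h : IsWeightedHomogeneous (fun _ => (2 : ℤ)) F c) (hc : c = 2 * n) : F.IsHomogeneous n := by
  intro m hm
  have := h hm
  rw [weight_const_two] at this
  rw [Pi.one_def, ← Finsupp.degree_eq_weight_one]
  omega

theorem pfaff_submatrix_mem_span_submaxPfEven {k : ℕ}
    (M : Matrix (Fin (2*k)) (Fin (2*k)) (MvPolynomial (Fin 4) ℂ))
    {e : Fin (2*(k-1)) → Fin (2*k)} (he : Function.Injective e) :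
    pfaff (M.submatrix e e) ∈ Ideal.span (submaxPfEven M) := by
  classical
  have hcard : (Finset.univ.image e).card = 2 * (k - 1) := by
    rw [Finset.card_image_of_injective _ he, Finset.card_univ, Fintype.card_fin]
  let e₀ := (Finset.univ.image e).orderEmbOfFin hcard
  have hex : ∀ j, ∃ j', e₀ j' = e j := fun j => by
    have : e j ∈ Set.range e₀ := by
      rw [Finset.range_orderEmbOfFin]
      simp
    exact this
  choose τ hτ using hex
  have hτinj : Function.Injective τ := fun x y hxy => he (by rw [← hτ, ← hτ, hxy])
  let τ' : Equiv.Perm (Fin (2*(k-1))) :=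
    Equiv.ofBijective τ (Finite.injective_iff_bijective.mp hτinj)
  have : M.submatrix e e = (M.submatrix e₀ e₀).submatrix τ' τ' := by
    ext1 a b
    simp [τ', hτ]
  have hmem : pfaff (M.submatrix e₀ e₀) ∈ Ideal.span (submaxPfEven M) :=
    Ideal.subset_span ⟨e₀, rfl⟩
  rw [this, pfaff_submatrix_perm]
  exact zsmul_mem hmem _

theorem pfIdeal_empty_le {k : ℕ} (G : MatTuple k) :
    pfIdeal (fun _ => ∅) G ≤ Ideal.span (⋃ i, submaxPfEven (G i)) := by
  refine Ideal.span_le.mpr ?_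
  rintro f ⟨i, e, he, -, rfl⟩
  exact Ideal.span_mono (Set.subset_iUnion _ i) (pfaff_submatrix_mem_span_submaxPfEven _ he)

theorem exists_le_sum_fin_four_eq {t : ℕ} (m : Fin 4 → ℕ) (h : t ≤ m 0 + m 1 + m 2 + m 3) :
    ∃ x : Fin 4 → ℕ, (∀ i, x i ≤ m i) ∧ x 0 + x 1 + x 2 + x 3 = t := by
  obtain ⟨x, hx, hxs⟩ := exists_le_sum_eq Finset.univ m (α := t) (by rwa [Fin.sum_univ_four])
  exact ⟨x, hx, by rwa [Fin.sum_univ_four] at hxs⟩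

theorem Fills.mono {I : Ideal (MvPolynomial (Fin 4) ℂ)} {t d : ℕ} (h : Fills I t) (htd : t ≤ d) :
    Fills I d := by
  refine fills_of_monomial_mem fun m hm => ?_
  obtain ⟨x, hx, hxs⟩ := exists_le_sum_fin_four_eq m (hm.symm ▸ htd)
  refine Ideal.mem_of_dvd _ (mul_dvd_mul (mul_dvd_mul (mul_dvd_mul (pow_dvd_pow _ (hx 0))
    (pow_dvd_pow _ (hx 1))) (pow_dvd_pow _ (hx 2))) (pow_dvd_pow _ (hx 3))) (h _ ?_)
  rw [← hxs]
  exact (((isHomogeneous_X_pow _ _).mul (isHomogeneous_X_pow _ _)).mul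
    (isHomogeneous_X_pow _ _)).mul (isHomogeneous_X_pow _ _)

/-- Fix a `2k × 2k` symmetric homogeneous matrix `A` of non-negative
integers. For a general choice of `k` skew-symmetric matrices `G 0, …, G (k-1)` of forms
in four variables, each with degree matrix `A`, the ideal generated by the submaximal
Pfaffians of all the `G i` contains every form of degree `d ≥ tr(A)/2`.
Genericity is expressed by a nonzero polynomial `P` in the coefficients of the tuple of
matrices, cutting out a nonempty Zariski-open subset of the parameter space. -/
theorem submax_pfaffians_of_k_general_matrices_fill_top_degrees
    (k : ℕ) (hk : 0 < k)
    (A : Matrix (Fin (2*k)) (Fin (2*k)) ℕ) (hsym : A.IsSymm) (hhom : HomogMat A) :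
    ∃ P : MvPolynomial (Fin k × Fin (2*k) × Fin (2*k) × ((Fin 4) →₀ ℕ)) ℂ, P ≠ 0 ∧
      (∃ G : Fin k → Matrix (Fin (2*k)) (Fin (2*k)) (MvPolynomial (Fin 4) ℂ),
        (∀ i, IsSkew (G i)) ∧ (∀ i, DegMat (G i) A) ∧
        MvPolynomial.eval
          (fun x => MvPolynomial.coeff x.2.2.2 (G x.1 x.2.1 x.2.2.1)) P ≠ 0) ∧
      ∀ G : Fin k → Matrix (Fin (2*k)) (Fin (2*k)) (MvPolynomial (Fin 4) ℂ),
        (∀ i, IsSkew (G i)) → (∀ i, DegMat (G i) A) →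
        MvPolynomial.eval
          (fun x => MvPolynomial.coeff x.2.2.2 (G x.1 x.2.1 x.2.2.1)) P ≠ 0 →
        ∀ d : ℕ, Matrix.trace A ≤ 2 * d →
          ∀ F : MvPolynomial (Fin 4) ℂ, F.IsHomogeneous d →
            F ∈ Ideal.span (⋃ i, submaxPfEven (G i)) := by
  have hdeg : ∀ a b, (A a a : ℤ) + A b b = 2 * A a b := fun a b => by
    have h1 := hhom a a b b
    rw [hsym.apply a b] at h1
    omega
  have hbal : BalancedDegrees k fun a => (A a a : ℤ) :=
    ⟨fun a b => by have := hdeg a b; omega, fun a => by omega, by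
      rw [Finset.filter_false_of_mem fun a _ => by omega]
      exact Nat.zero_le _⟩
  obtain ⟨t, ht⟩ : ∃ t : ℕ, ∑ a, (A a a : ℤ) = 2 * t := by
    obtain ⟨-, -, -, D, -, hD⟩ := hbal.exists_pairing (p := ⟨0, by omega⟩) (q := ⟨1, by omega⟩)
      (by simp)
    exact ⟨A ⟨0, by omega⟩ ⟨1, by omega⟩ + ∑ i, D i, by rw [hD, hdeg]; push_cast; ring⟩
  obtain ⟨G₀, hG₀, hf₀⟩ := exists_fills_of_four_variables hk t (fun _ : Fin k => hbal)
    fun _ => ht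
  obtain ⟨P, hP₀, hP⟩ := Fills.exists_open (span_X_isHomogeneous _) hf₀
  refine ⟨P, ?_, ⟨G₀, fun i => (hG₀ i).1, fun i a b =>
    isHomogeneous_of_isWeightedHomogeneous_two ((hG₀ i).2 a b) (hdeg a b), hP₀⟩, ?_⟩
  · rintro rfl
    simp at hP₀
  · intro G hG hGA hPG d hd F hF
    have hfill := hP _ G (fun i => ⟨hG i, fun a b =>
      IsHomogeneous.isWeightedHomogeneous_two (hGA i a b) (hdeg a b)⟩) hPG
    rw [Set.image_empty, Ideal.span_empty, bot_sup_eq] at hfill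
    have htd : t ≤ d := by
      have : Matrix.trace A = 2 * t := by exact_mod_cast ht
      omega
    exact pfIdeal_empty_le G (hfill.mono htd F hF)
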